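/- arXiv:1204.2775 — 3 statements merged into one kernel-verified Lean document; each statement's English description precedes it below -/
import Mathlib

section
/- Let Ω ⊆ ℝ^d (d ≥ 1) be a nonempty open connected set and let f : ℝ^d → ℝ be real analytic on Ω (i.e., at every point of Ω, f is given by a convergent power series) with f not identically zero on Ω. Then for every compact set Δ ⊆ Ω one has ∫_Δ |log|f(x)|| dx < ∞; that is, the function x ↦ log|f(x)| is Lebesgue-integrable on Δ. -/
open MeasureTheory

/-- A sublevel set estimate of van der Corput type: if `|g⁽ᵏ⁾| ≥ c` on an interval, then `|g| ≤ ε`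
can only hold on a set whose measure is at most a constant times a power of `ε / c`. -/
theorem exists_volume_sublevel_le_rpow (k : ℕ) :
    ∃ C α : ℝ, 0 ≤ C ∧ 0 < α ∧ α ≤ 1 ∧ ∀ (a b c ε : ℝ) (g : ℕ → ℝ → ℝ), 0 < ε → ε < c →
      (∀ j, ∀ t ∈ Set.Icc a b, HasDerivAt (g j) (g (j + 1) t) t) →
      (∀ t ∈ Set.Icc a b, c ≤ |g k t|) →
      volume {t ∈ Set.Icc a b | |g 0 t| ≤ ε} ≤ ENNReal.ofReal (C * (ε / c) ^ α) := by
  induction k with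
  | zero =>
    refine ⟨0, 1, le_rfl, one_pos, le_rfl, fun a b c ε g _ hc _ hg => ?_⟩
    have : {t ∈ Set.Icc a b | |g 0 t| ≤ ε} = ∅ := by
      ext t
      simp only [Set.mem_ofPred_eq, Set.mem_empty_iff_false, iff_false, not_and, not_le]
      exact fun ht => hc.trans_le (hg t ht)
    rw [this, measure_empty]
    exact zero_le
  | succ k ih =>
    obtain ⟨C, α, hC, hα, hα1, ih⟩ := ih
    refine ⟨2 * C + 4, α / 2, by positivity, by positivity, by linarith,
      fun a b c ε g hε hc hg hgk => ?_⟩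
    have hc0 : 0 < c := hε.trans hc
    set q := ε / c with hq
    have hq0 : 0 < q := div_pos hε hc0
    have hq1 : q < 1 := (div_lt_one hc0).2 hc
    set s := q ^ (1 / 2 : ℝ) with hs
    have hs0 : 0 < s := Real.rpow_pos_of_pos hq0 _
    have hss : s * s = q := by
      rw [hs, ← Real.rpow_add hq0]; norm_num
    have hs1 : s < 1 := by nlinarith
    have hsα : s ^ α = q ^ (α / 2) := by
      rw [hs, ← Real.rpow_mul hq0.le]; congr 1; ring
    have hss' : s ≤ s ^ α := by
      simpa using Real.rpow_le_rpow_of_exponent_ge hs0 hs1.le hα1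
    set δ := c * s with hδ
    have hεcs : ε = c * (s * s) := by rw [hss, hq]; field_simp
    have hεδ : ε < δ := by
      rw [hεcs, hδ]; nlinarith [mul_pos hc0 hs0]
    have hεδs : ε / δ = s := by
      rw [hεcs, hδ]; field_simp
    have hslope : ∀ x ∈ Set.Icc a b, ∀ y ∈ Set.Icc a b, x < y → |g k x| < δ → |g k y| < δ →
        y - x < 2 * s := by
      intro x hx y hy hxy hgx hgy
      have hsub : Set.Icc x y ⊆ Set.Icc a b := Set.Icc_subset_Icc hx.1 hy.2
      obtain ⟨z, hz, hzs⟩ := exists_hasDerivAt_eq_slope (g k) (g (k + 1)) hxy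
        (fun t ht => (hg k t (hsub ht)).continuousAt.continuousWithinAt)
        (fun t ht => hg k t (hsub (Set.Ioo_subset_Icc_self ht)))
      have h1 := hgk z (hsub (Set.Ioo_subset_Icc_self hz))
      have hyx : 0 < y - x := sub_pos.2 hxy
      rw [hzs, abs_div, abs_of_pos hyx, le_div_iff₀ hyx] at h1
      have h2 := abs_sub (g k y) (g k x)
      have h3 : c * (y - x) < c * (2 * s) := by rw [hδ] at hgx hgy; linarith
      exact lt_of_mul_lt_mul_left h3 hc0.le
    have hmain : volume {t ∈ Set.Icc a b | |g 0 t| ≤ ε} ≤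
        ENNReal.ofReal (C * s ^ α) + ENNReal.ofReal (4 * s) + ENNReal.ofReal (C * s ^ α) := by
      have hpiece : ∀ a' b', Set.Icc a' b' ⊆ Set.Icc a b → (∀ t ∈ Set.Icc a' b', δ ≤ |g k t|) →
          volume {t ∈ Set.Icc a' b' | |g 0 t| ≤ ε} ≤ ENNReal.ofReal (C * s ^ α) := by
        intro a' b' hsub hδg
        have := ih a' b' δ ε g hε hεδ (fun j t ht => hg j t (hsub ht)) hδg
        rwa [hεδs] at this
      by_cases hex : ∃ p ∈ Set.Icc a b, |g k p| < δ
      · obtain ⟨p, hp, hgp⟩ := hex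
        have hcov : {t ∈ Set.Icc a b | |g 0 t| ≤ ε} ⊆
            {t ∈ Set.Icc a (p - 2 * s) | |g 0 t| ≤ ε} ∪ Set.Icc (p - 2 * s) (p + 2 * s) ∪
              {t ∈ Set.Icc (p + 2 * s) b | |g 0 t| ≤ ε} := by
          rintro t ⟨ht, htε⟩
          rcases le_total t (p - 2 * s) with h | h
          · exact Or.inl (Or.inl ⟨⟨ht.1, h⟩, htε⟩)
          rcases le_total t (p + 2 * s) with h' | h'
          · exact Or.inl (Or.inr ⟨h, h'⟩)
          · exact Or.inr ⟨⟨h', ht.2⟩, htε⟩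
        refine (measure_mono hcov).trans ((measure_union_le _ _).trans
          (add_le_add ((measure_union_le _ _).trans (add_le_add ?_ ?_)) ?_))
        · refine hpiece _ _ (Set.Icc_subset_Icc_right (by linarith [hp.2])) fun t ht => ?_
          by_contra! hlt
          have := hslope t ⟨ht.1, by linarith [ht.2, hp.2]⟩ p hp (by linarith [ht.2]) hlt hgp
          linarith [ht.2]
        · rw [Real.volume_Icc]
          exact ENNReal.ofReal_le_ofReal (by linarith)
        · refine hpiece _ _ (Set.Icc_subset_Icc_left (by linarith [hp.1])) fun t ht => ?_
          by_contra! hlt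
          have := hslope p hp t ⟨by linarith [ht.1, hp.1], ht.2⟩ (by linarith [ht.1]) hgp hlt
          linarith [ht.1]
      · push Not at hex
        exact (hpiece a b subset_rfl hex).trans (by rw [add_assoc]; exact le_self_add)
    refine hmain.trans ?_
    rw [← ENNReal.ofReal_add (by positivity) (by positivity),
      ← ENNReal.ofReal_add (by positivity) (by positivity), ← hsα]
    exact ENNReal.ofReal_le_ofReal (by linarith)

/-- A function whose distribution function has an exponentially decaying tail is integrable. -/
theorem integrable_of_measure_le_exp {X : Type*} [MeasurableSpace X] {μ : Measure X}
    [IsFiniteMeasure μ] {φ : X → ℝ} (hφ : AEMeasurable φ μ) {α : ℝ} (hα : 0 < α) (T K : ℝ)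
    (hdecay : ∀ t, T < t → μ {x | t ≤ |φ x|} ≤ ENNReal.ofReal (K * Real.exp (-α * t))) :
    Integrable φ μ := by
  refine ⟨hφ.aestronglyMeasurable, ?_⟩
  have hcake := lintegral_eq_lintegral_meas_le μ (f := fun x => |φ x|)
    (Filter.Eventually.of_forall fun x => abs_nonneg _) hφ.norm
  rw [hasFiniteIntegral_iff_norm]
  simp only [Real.norm_eq_abs]
  rw [hcake]
  have hsub : Set.Ioi (0 : ℝ) ⊆ Set.Ioc 0 T ∪ Set.Ioi T := fun t ht => by
    rcases le_or_gt t T with h | h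
    · exact Or.inl ⟨ht, h⟩
    · exact Or.inr h
  refine (lintegral_mono_set hsub).trans_lt ((lintegral_union_le _ _ _).trans_lt
    (ENNReal.add_lt_top.2 ⟨?_, ?_⟩))
  · calc ∫⁻ t in Set.Ioc 0 T, μ {x | t ≤ |φ x|}
        ≤ ∫⁻ _ in Set.Ioc 0 T, μ Set.univ := lintegral_mono fun t => measure_mono (Set.subset_univ _)
      _ < ⊤ := by
        rw [setLIntegral_const, Real.volume_Ioc]
        exact ENNReal.mul_lt_top (measure_lt_top _ _) ENNReal.ofReal_lt_top
  · refine (setLIntegral_mono' measurableSet_Ioi hdecay).trans_lt ?_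
    exact ((exp_neg_integrableOn_Ioi T hα).const_mul K).lintegral_lt_top

/-- If all segments in direction `v` of parameter length `τ` meet `S`, contained in a ball of radius
`r`, in a set of measure at most `B`, then `S` has volume at most `B / τ` times that of the ball of
radius `2 r`. -/
theorem mul_measure_le_of_segment_measure_le {E : Type*} [NormedAddCommGroup E] [NormedSpace ℝ E]
    [MeasurableSpace E] [BorelSpace E] [SecondCountableTopology E] (μ : Measure E) [SFinite μ]
    [μ.IsAddRightInvariant] {S : Set E} (hS : MeasurableSet S) {x₀ v : E} {r τ : ℝ}
    (hSr : S ⊆ Metric.ball x₀ r) (hτv : τ * ‖v‖ ≤ r) {B : ENNReal}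
    (hB : ∀ x ∈ Metric.ball x₀ (2 * r), volume {t ∈ Set.Icc 0 τ | x + t • v ∈ S} ≤ B) :
    ENNReal.ofReal τ * μ S ≤ B * μ (Metric.ball x₀ (2 * r)) := by
  have hmeas : Measurable fun p : ℝ × E => p.2 + p.1 • v := by fun_prop
  calc ENNReal.ofReal τ * μ S
      = ∫⁻ t in Set.Icc 0 τ, ∫⁻ x, S.indicator 1 (x + t • v) ∂μ := by
        simp_rw [lintegral_add_right_eq_self (μ := μ) (S.indicator 1), lintegral_indicator_one hS]
        rw [setLIntegral_const, Real.volume_Icc, sub_zero, mul_comm]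
    _ = ∫⁻ x, (∫⁻ t in Set.Icc 0 τ, S.indicator 1 (x + t • v)) ∂μ :=
        lintegral_lintegral_swap ((measurable_one.indicator hS).comp hmeas).aemeasurable
    _ ≤ ∫⁻ x, (Metric.ball x₀ (2 * r)).indicator (fun _ => B) x ∂μ := by
        refine lintegral_mono fun x => ?_
        have hSx : MeasurableSet {t : ℝ | x + t • v ∈ S} :=
          (show Measurable fun t : ℝ => x + t • v by fun_prop) hS
        have heq : ∫⁻ t in Set.Icc 0 τ, S.indicator (1 : E → ENNReal) (x + t • v) =
            volume {t ∈ Set.Icc 0 τ | x + t • v ∈ S} := by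
          change ∫⁻ t in Set.Icc 0 τ, {t : ℝ | x + t • v ∈ S}.indicator 1 t = _
          rw [lintegral_indicator_one hSx, Measure.restrict_apply hSx, Set.inter_comm]
          rfl
        rw [heq]
        by_cases hx : x ∈ Metric.ball x₀ (2 * r)
        · rw [Set.indicator_of_mem hx]
          exact hB x hx
        · rw [Set.indicator_of_notMem hx]
          have : {t ∈ Set.Icc 0 τ | x + t • v ∈ S} = ∅ := by
            ext t
            simp only [Set.mem_ofPred_eq, Set.mem_empty_iff_false, iff_false, not_and]
            intro ht htS
            apply hx
            have h1 := mem_ball_iff_norm.1 (hSr htS)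
            have h2 : ‖t • v‖ ≤ r := by
              rw [norm_smul, Real.norm_eq_abs, abs_of_nonneg ht.1]
              exact (mul_le_mul_of_nonneg_right ht.2 (norm_nonneg _)).trans hτv
            rw [mem_ball_iff_norm]
            have h3 := norm_sub_le (x + t • v - x₀) (t • v)
            rw [show x + t • v - x₀ - t • v = x - x₀ by abel] at h3
            linarith
          rw [this, measure_empty]
    _ = B * μ (Metric.ball x₀ (2 * r)) := by
        rw [lintegral_indicator Metric.isOpen_ball.measurableSet, setLIntegral_const]

section DirDeriv

variable {E : Type*} [NormedAddCommGroup E] [NormedSpace ℝ E]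

/-- The `j`-th iterated directional derivative of `f` in direction `v`. -/
noncomputable def iteratedDirDeriv (f : E → ℝ) (v : E) : ℕ → E → ℝ
  | 0 => f
  | j + 1 => fun x => fderiv ℝ (iteratedDirDeriv f v j) x v

theorem AnalyticOnNhd.iteratedDirDeriv {f : E → ℝ} {U : Set E} (hf : AnalyticOnNhd ℝ f U) (v : E)
    (j : ℕ) : AnalyticOnNhd ℝ (iteratedDirDeriv f v j) U := by
  induction j with
  | zero => exact hf
  | succ j ih =>
    exact fun x hx =>
      ((ContinuousLinearMap.apply ℝ ℝ v).analyticAt _).comp (ih.fderiv x hx)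

theorem AnalyticOnNhd.hasDerivAt_iteratedDirDeriv {f : E → ℝ} {U : Set E}
    (hf : AnalyticOnNhd ℝ f U) (v : E) (j : ℕ) (x : E) {t : ℝ} (hx : x + t • v ∈ U) :
    HasDerivAt (fun s : ℝ => _root_.iteratedDirDeriv f v j (x + s • v))
      (_root_.iteratedDirDeriv f v (j + 1) (x + t • v)) t := by
  have h1 : HasDerivAt (fun s : ℝ => x + s • v) v t := by
    simpa using ((hasDerivAt_id t).smul_const v).const_add x
  exact ((hf.iteratedDirDeriv v j _ hx).differentiableAt.hasFDerivAt).comp_hasDerivAt t h1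

/-- A real analytic function on a ball which is nonzero at some point has a nonvanishing iterated
directional derivative at the center, in the direction of that point. -/
theorem AnalyticOnNhd.exists_iteratedDirDeriv_ne_zero {f : E → ℝ} {x₀ v : E} {R : ℝ}
    (hf : AnalyticOnNhd ℝ f (Metric.ball x₀ R)) (hv : x₀ + v ∈ Metric.ball x₀ R)
    (hfv : f (x₀ + v) ≠ 0) : ∃ k, _root_.iteratedDirDeriv f v k x₀ ≠ 0 := by
  by_contra! hzero
  set ℓ : ℝ → E := fun t => x₀ + t • v with hℓ
  set U : Set ℝ := ℓ ⁻¹' Metric.ball x₀ R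
  have hℓc : Continuous ℓ := by fun_prop
  have hUo : IsOpen U := Metric.isOpen_ball.preimage hℓc
  have hℓa : ∀ t, AnalyticAt ℝ ℓ t := fun t => by fun_prop
  have hR : 0 < R := dist_nonneg.trans_lt hv
  have h0 : (0 : ℝ) ∈ U := by simp [U, ℓ, hR]
  have h1 : (1 : ℝ) ∈ U := by simpa [U, ℓ] using hv
  have hUc : IsPreconnected U := by
    have : U = AffineMap.lineMap x₀ (x₀ + v) ⁻¹' Metric.ball x₀ R := by
      ext t; simp [U, ℓ, AffineMap.lineMap_apply, add_comm]
    rw [this]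
    exact ((convex_ball x₀ R).affine_preimage _).isPreconnected
  have hfa : AnalyticOnNhd ℝ (f ∘ ℓ) U := fun t ht => (hf _ ht).comp (hℓa t)
  have hiter : ∀ j, Set.EqOn (iteratedDeriv j (f ∘ ℓ))
      (fun t => _root_.iteratedDirDeriv f v j (x₀ + t • v)) U := by
    intro j
    induction j with
    | zero => intro t _; simp [_root_.iteratedDirDeriv, ℓ]
    | succ j ih =>
      intro t ht
      rw [iteratedDeriv_succ, (ih.eventuallyEq_of_mem (hUo.mem_nhds ht)).deriv_eq]
      exact (hf.hasDerivAt_iteratedDirDeriv v j x₀ ht).deriv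
  have htop : analyticOrderAt (f ∘ ℓ) 0 = ⊤ := by
    refine ENat.eq_top_iff_forall_ge.2 fun n => ?_
    refine (natCast_le_analyticOrderAt_iff_iteratedDeriv_eq_zero (hfa 0 h0)).2 fun i _ => ?_
    rw [hiter i h0]
    simpa using hzero i
  have := hfa.eqOn_zero_of_preconnected_of_eventuallyEq_zero hUc h0
    (analyticOrderAt_eq_top.1 htop) h1
  exact hfv (by simpa [ℓ] using this)

end DirDeriv

/-- The logarithm of a real analytic function is integrable near every point around which the
function does not vanish identically. -/
theorem AnalyticAt.integrableAtFilter_log_abs {E : Type*} [NormedAddCommGroup E] [NormedSpace ℝ E]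
    [FiniteDimensional ℝ E] [MeasurableSpace E] [BorelSpace E] (μ : Measure E)
    [μ.IsAddHaarMeasure] {f : E → ℝ} {x₀ : E} (hf : AnalyticAt ℝ f x₀)
    (hne : ∃ᶠ x in nhds x₀, f x ≠ 0) :
    IntegrableAtFilter (fun x => Real.log |f x|) (nhds x₀) μ := by
  obtain ⟨R₀, hR₀, hfR₀⟩ := Metric.eventually_nhds_iff_ball.1 hf.eventually_analyticAt
  obtain ⟨y, hfy, hy⟩ := (hne.and_eventually (Metric.ball_mem_nhds x₀ hR₀)).exists
  set v := y - x₀ with hv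
  have hyv : x₀ + v = y := by simp [hv]
  obtain ⟨k, hk⟩ := AnalyticOnNhd.exists_iteratedDirDeriv_ne_zero (v := v) (R := R₀) hfR₀
    (by rwa [hyv]) (by rwa [hyv])
  set c := |iteratedDirDeriv f v k x₀| / 2 with hc
  have hc0 : 0 < c := by positivity
  have hcont : ContinuousAt (iteratedDirDeriv f v k) x₀ :=
    (AnalyticOnNhd.iteratedDirDeriv hfR₀ v k x₀ (Metric.mem_ball_self hR₀)).continuousAt
  have hck : ∀ᶠ x in nhds x₀, c < |iteratedDirDeriv f v k x| :=
    hcont.abs.eventually_const_lt (half_lt_self (abs_pos.2 hk))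
  have hM : ∀ᶠ x in nhds x₀, |f x| < |f x₀| + 1 :=
    hf.continuousAt.abs.eventually_lt_const (lt_add_one _)
  obtain ⟨R, hR, hball⟩ := Metric.eventually_nhds_iff_ball.1
    (hf.eventually_analyticAt.and (hck.and hM))
  set r := R / 3 with hr
  have hr0 : 0 < r := by positivity
  set τ := r / (‖v‖ + 1) with hτ
  have hτ0 : 0 < τ := by positivity
  have hτv : τ * ‖v‖ ≤ r := by
    rw [hτ, div_mul_eq_mul_div, div_le_iff₀ (by positivity)]
    nlinarith
  have hrR : Metric.ball x₀ r ⊆ Metric.ball x₀ R := Metric.ball_subset_ball (by linarith)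
  have hfa : AnalyticOnNhd ℝ f (Metric.ball x₀ R) := fun x hx => (hball x hx).1
  have hseg : ∀ x ∈ Metric.ball x₀ (2 * r), ∀ t ∈ Set.Icc 0 τ, x + t • v ∈ Metric.ball x₀ R := by
    intro x hx t ht
    rw [mem_ball_iff_norm] at hx ⊢
    have h1 : ‖t • v‖ ≤ r := by
      rw [norm_smul, Real.norm_eq_abs, abs_of_nonneg ht.1]
      exact (mul_le_mul_of_nonneg_right ht.2 (norm_nonneg _)).trans hτv
    have h2 := norm_add_le (x - x₀) (t • v)
    rw [show x - x₀ + t • v = x + t • v - x₀ by abel] at h2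
    linarith
  obtain ⟨C, α, hC, hα, -, hsub⟩ := exists_volume_sublevel_le_rpow k
  have hfc : ContinuousOn f (Metric.ball x₀ r) := hfa.continuousOn.mono hrR
  set V := (μ (Metric.ball x₀ (2 * r))).toReal with hV
  have hVtop : μ (Metric.ball x₀ (2 * r)) = ENNReal.ofReal V :=
    (ENNReal.ofReal_toReal measure_ball_lt_top.ne).symm
  have hlevel : ∀ ε, 0 < ε → ε < c → μ {x ∈ Metric.ball x₀ r | |f x| ≤ ε} ≤
      ENNReal.ofReal (C * (ε / c) ^ α * V / τ) := by
    intro ε hε hεc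
    have hS : MeasurableSet {x ∈ Metric.ball x₀ r | |f x| ≤ ε} := by
      obtain ⟨F, hF, hFeq⟩ := continuousOn_iff_isClosed.1 hfc.abs (Set.Iic ε) isClosed_Iic
      have : {x ∈ Metric.ball x₀ r | |f x| ≤ ε} =
          (fun x => |f x|) ⁻¹' Set.Iic ε ∩ Metric.ball x₀ r := by
        ext x; simp [and_comm]
      rw [this, hFeq]
      exact hF.measurableSet.inter Metric.isOpen_ball.measurableSet
    have := mul_measure_le_of_segment_measure_le μ hS (fun x hx => hx.1) hτv
      (B := ENNReal.ofReal (C * (ε / c) ^ α)) fun x hx => by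
        refine (measure_mono ?_).trans (hsub 0 τ c ε
          (fun j t => iteratedDirDeriv f v j (x + t • v)) hε hεc
          (fun j t ht => hfa.hasDerivAt_iteratedDirDeriv v j x (hseg x hx t ht))
          (fun t ht => (hball _ (hseg x hx t ht)).2.1.le))
        exact fun t ht => ⟨ht.1, ht.2.2⟩
    rw [hVtop, ← ENNReal.ofReal_mul (by positivity)] at this
    rw [ENNReal.ofReal_div_of_pos hτ0, ENNReal.le_div_iff_mul_le (by simp [hτ0]) (by simp),
      mul_comm]
    exact this
  refine ⟨Metric.ball x₀ r, Metric.ball_mem_nhds x₀ hr0, ?_⟩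
  have : IsFiniteMeasure (μ.restrict (Metric.ball x₀ r)) :=
    isFiniteMeasure_restrict.2 measure_ball_lt_top.ne
  have hae : AEMeasurable (fun x => Real.log |f x|) (μ.restrict (Metric.ball x₀ r)) :=
    Real.measurable_log.comp_aemeasurable
      (hfc.abs.aemeasurable Metric.isOpen_ball.measurableSet)
  refine integrable_of_measure_le_exp hae hα (max (Real.log (|f x₀| + 1)) (-Real.log c))
    (C * (1 / c) ^ α * V / τ) fun t ht => ?_
  obtain ⟨htM, htc⟩ := max_lt_iff.1 ht
  have ht0 : 0 < t := (Real.log_nonneg (by linarith [abs_nonneg (f x₀)])).trans_lt htM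
  have hexp : Real.exp (-t) < c := by
    rw [← Real.lt_log_iff_exp_lt hc0]; linarith
  rw [Measure.restrict_apply' Metric.isOpen_ball.measurableSet]
  calc μ ({x | t ≤ |Real.log (|f x|)|} ∩ Metric.ball x₀ r)
      ≤ μ {x ∈ Metric.ball x₀ r | |f x| ≤ Real.exp (-t)} := by
        refine measure_mono fun x hx => ⟨hx.2, ?_⟩
        rcases (abs_nonneg (f x)).eq_or_lt with h0 | h0
        · rw [← h0]; positivity
        have hlog : Real.log |f x| ≤ Real.log (|f x₀| + 1) :=
          Real.log_le_log h0 (hball x (hrR hx.2)).2.2.le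
        rw [← Real.log_le_iff_le_exp h0]
        have hxt : t ≤ |Real.log (|f x|)| := hx.1
        rcases le_abs.1 hxt with h | h <;> linarith
    _ ≤ _ := hlevel _ (Real.exp_pos _) hexp
    _ = _ := by
        congr 1
        rw [div_eq_mul_one_div (Real.exp (-t)) c, Real.mul_rpow (Real.exp_pos _).le (by positivity),
          ← Real.exp_mul, show -t * α = -α * t by ring]
        ring

/-- Theorem 4 of the paper (via Hironaka's resolution of singularities): if `f` is real
analytic on a nonempty open connected set `Ω ⊆ ℝ^d` and not identically zero on `Ω`,
then `x ↦ log |f x|` is Lebesgue-integrable on every compact `Δ ⊆ Ω`. -/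
theorem log_abs_analytic_integrable_on_compact
    (d : ℕ) (hd : 1 ≤ d) (Ω : Set (Fin d → ℝ)) (hΩopen : IsOpen Ω)
    (hΩconn : IsConnected Ω) (f : (Fin d → ℝ) → ℝ) (hf : AnalyticOnNhd ℝ f Ω)
    (hne : ∃ x ∈ Ω, f x ≠ 0) (Δ : Set (Fin d → ℝ)) (hΔΩ : Δ ⊆ Ω) (hΔ : IsCompact Δ) :
    IntegrableOn (fun x => Real.log |f x|) Δ volume := by
  refine LocallyIntegrableOn.integrableOn_isCompact (fun x hx => ?_) hΔ
  refine (AnalyticAt.integrableAtFilter_log_abs volume (hf x (hΔΩ hx)) fun hzero => ?_).filter_mono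
    nhdsWithin_le_nhds
  obtain ⟨y, hy, hfy⟩ := hne
  refine hfy (hf.eqOn_zero_of_preconnected_of_eventuallyEq_zero hΩconn.isPreconnected
    (hΔΩ hx) ?_ hy)
  filter_upwards [hzero] with z hz
  simpa using hz
end

section
/- Define additionally, for x ∈ ℂ^G and h ∈ ℂ^{RQ}, the n×n matrices J(h,x) := P·[ I_R ⊗ diag(x)A ∣ a_{α+1}(h) ∣ ⋯ ∣ a_G(h) ], J1(x) := P (I_R ⊗ diag(x)) Pᵀ, and J3(x) := the block-diagonal matrix diag(I_{RQ}, diag(x_{α+1},…,x_G)^{−1}). If x_i ≠ 0 for all i ∈ {α+1,…,G}, then det J(h,x) = det J1(x) · det J2(h) · det J3(x). -/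
open Matrix MeasureTheory
open scoped Kronecker

noncomputable section

/-- `α := max(1, RQ + G − RG)` (natural subtraction). -/
def alphaP (R Q G : ℕ) : ℕ := max 1 (R * Q + G - R * G)

/-- `β := R(G−Q) − (G−1)` if this is positive, and `0` otherwise (natural subtraction). -/
def betaP (R Q G : ℕ) : ℕ := R * (G - Q) - (G - 1)

/-- `n := RQ + G − α`. -/
def nP (R Q G : ℕ) : ℕ := R * Q + G - alphaP R Q G

/-- The 0-based global row index of the `m`-th (0-based) element of the index set `I`:
the first `β` blocks have size `G−1` (rows `rG, …, rG+G−2`), the remaining blocks have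
size `G` (rows `rG, …, rG+G−1`); elements are listed in increasing order. -/
def rowIdx (G β m : ℕ) : ℕ :=
  if m < β * (G - 1) then (m / (G - 1)) * G + m % (G - 1)
  else β * G + ((m - β * (G - 1)) / G) * G + (m - β * (G - 1)) % G

/-- The `n × RG` matrix `P` whose rows are the rows of the `RG × RG` identity matrix
with indices in `I`, listed in increasing order. -/
def Pmat (R Q G : ℕ) : Matrix (Fin (nP R Q G)) (Fin (R * G)) ℂ :=
  Matrix.of fun i j => if rowIdx G (betaP R Q G) (i : ℕ) = (j : ℕ) then 1 else 0

/-- `I_R ⊗ M`, reindexed to row-major block form via `finProdFinEquiv`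
(so block `r` of rows is `{rG, …, rG+G−1}`). -/
def kronId (R : ℕ) {G Q : ℕ} (M : Matrix (Fin G) (Fin Q) ℂ) :
    Matrix (Fin (R * G)) (Fin (R * Q)) ℂ :=
  Matrix.reindex finProdFinEquiv finProdFinEquiv ((1 : Matrix (Fin R) (Fin R) ℂ) ⊗ₖ M)

/-- `a_i(h) := (I_R ⊗ diag(e_i) A) h`, where `i` is a 0-based row index in `{0, …, G−1}`
(so 1-based index `i+1`). -/
def aVec (R : ℕ) {G Q : ℕ} (A : Matrix (Fin G) (Fin Q) ℂ) (i : ℕ) (h : Fin (R * Q) → ℂ) :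
    Fin (R * G) → ℂ :=
  (kronId R (Matrix.diagonal (fun j : Fin G => if (j : ℕ) = i then (1 : ℂ) else 0) * A)).mulVec h

/-- The `n×n` matrix `P·[ I_R ⊗ M ∣ a_{α+1}(h) ∣ ⋯ ∣ a_G(h) ]`, where the columns
`a_i(h)` are built from the matrix `A`. -/
def bigMat (R Q G : ℕ) (M A : Matrix (Fin G) (Fin Q) ℂ) (h : Fin (R * Q) → ℂ) :
    Matrix (Fin (nP R Q G)) (Fin (nP R Q G)) ℂ :=
  Matrix.of fun i j =>
    if hj : (j : ℕ) < R * Q then (Pmat R Q G * kronId R M) i ⟨(j : ℕ), hj⟩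
    else (Pmat R Q G).mulVec (aVec R A (alphaP R Q G + ((j : ℕ) - R * Q)) h) i

/-- `J2(h) := P·[ I_R ⊗ A ∣ a_{α+1}(h) ∣ ⋯ ∣ a_G(h) ]`. -/
def J2mat (R Q G : ℕ) (A : Matrix (Fin G) (Fin Q) ℂ) (h : Fin (R * Q) → ℂ) :
    Matrix (Fin (nP R Q G)) (Fin (nP R Q G)) ℂ :=
  bigMat R Q G A A h

/-- `J(h,x) := P·[ I_R ⊗ diag(x)A ∣ a_{α+1}(h) ∣ ⋯ ∣ a_G(h) ]`. -/
def Jmat (R Q G : ℕ) (A : Matrix (Fin G) (Fin Q) ℂ) (h : Fin (R * Q) → ℂ) (x : Fin G → ℂ) :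
    Matrix (Fin (nP R Q G)) (Fin (nP R Q G)) ℂ :=
  bigMat R Q G (Matrix.diagonal x * A) A h

/-- `J1(x) := P (I_R ⊗ diag(x)) Pᵀ`. -/
def J1mat (R Q G : ℕ) (x : Fin G → ℂ) :
    Matrix (Fin (nP R Q G)) (Fin (nP R Q G)) ℂ :=
  Pmat R Q G * kronId R (Matrix.diagonal x) * (Pmat R Q G)ᵀ

/-- Entry of a vector indexed by a natural number (junk value `0` out of range). -/
def entryAt {G : ℕ} (x : Fin G → ℂ) (k : ℕ) : ℂ := if hk : k < G then x ⟨k, hk⟩ else 0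

/-- `J3(x) := diag(I_{RQ}, diag(x_{α+1}, …, x_G)⁻¹)`. -/
def J3mat (R Q G : ℕ) (x : Fin G → ℂ) :
    Matrix (Fin (nP R Q G)) (Fin (nP R Q G)) ℂ :=
  Matrix.of fun i j =>
    if i = j then
      (if (i : ℕ) < R * Q then 1 else (entryAt x (alphaP R Q G + ((i : ℕ) - R * Q)))⁻¹)
    else 0

lemma rowIdx_injective {G : ℕ} (hG : 1 < G) (β : ℕ) : Function.Injective (rowIdx G β) := by
  obtain ⟨g, rfl⟩ : ∃ g, G = g + 1 := ⟨G - 1, by omega⟩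
  have hg : 0 < g := by omega
  have hlow : ∀ m, m < β * g → rowIdx (g + 1) β m = m + m / g ∧ m / g < β := by
    intro m hm
    refine ⟨?_, (Nat.div_lt_iff_lt_mul hg).2 hm⟩
    have := Nat.div_add_mod m g
    simp only [rowIdx, Nat.add_sub_cancel, if_pos hm]
    linarith
  have hhigh : ∀ m, ¬ m < β * g → rowIdx (g + 1) β m = m + β := by
    intro m hm
    have := Nat.div_add_mod (m - β * g) (g + 1)
    have := Nat.add_sub_cancel' (not_lt.1 hm)
    simp only [rowIdx, Nat.add_sub_cancel, if_neg hm]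
    linarith
  refine StrictMono.injective (strictMono_nat_of_lt_succ fun m => ?_)
  by_cases h₂ : m + 1 < β * g
  · rw [(hlow m (by omega)).1, (hlow _ h₂).1]
    have : m / g ≤ (m + 1) / g := Nat.div_le_div_right (Nat.le_succ m)
    omega
  · rw [hhigh _ h₂]
    by_cases h₁ : m < β * g
    · have := hlow m h₁
      omega
    · rw [hhigh _ h₁]
      omega

lemma kronId_diagonal (R : ℕ) {G : ℕ} (x : Fin G → ℂ) :
    kronId R (diagonal x) = diagonal fun a : Fin (R * G) => x a.modNat := by
  ext a b
  simp only [kronId, ← diagonal_one, diagonal_kronecker_diagonal, reindex_apply,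
    submatrix_diagonal_equiv]
  simp [finProdFinEquiv, Function.comp_def]

lemma kronId_mul (R : ℕ) {G Q S : ℕ} (M : Matrix (Fin G) (Fin Q) ℂ)
    (N : Matrix (Fin Q) (Fin S) ℂ) : kronId R (M * N) = kronId R M * kronId R N := by
  simp only [kronId, reindex_apply, submatrix_mul_equiv, ← mul_kronecker_mul, one_mul]

lemma aVec_apply (R : ℕ) {G Q : ℕ} (A : Matrix (Fin G) (Fin Q) ℂ) (k : ℕ)
    (h : Fin (R * Q) → ℂ) (a : Fin (R * G)) :
    aVec R A k h a = if (a.modNat : ℕ) = k then (kronId R A *ᵥ h) a else 0 := by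
  rw [aVec, kronId_mul, kronId_diagonal, ← mulVec_mulVec, mulVec_diagonal, ite_mul, one_mul, zero_mul]

/-- The coordinate `x_g` selected by the `i`-th row of `P`, where `g` is the position of that
row inside its block of size `G`. -/
def selectedCoord (R Q G : ℕ) (x : Fin G → ℂ) (i : Fin (nP R Q G)) : ℂ :=
  if hi : rowIdx G (betaP R Q G) i < R * G then
    x (⟨rowIdx G (betaP R Q G) i, hi⟩ : Fin (R * G)).modNat
  else 0

lemma Pmat_mul_modNat (R Q G : ℕ) (x : Fin G → ℂ) (i : Fin (nP R Q G)) (a : Fin (R * G)) :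
    Pmat R Q G i a * x a.modNat = selectedCoord R Q G x i * Pmat R Q G i a := by
  simp only [Pmat, of_apply, selectedCoord]
  split_ifs with h₁ h₂ h₂
  · simp [h₁]
  · exact absurd (h₁ ▸ a.isLt) h₂
  · simp
  · simp

lemma Pmat_mulVec_modNat_mul (R Q G : ℕ) (x : Fin G → ℂ) (v : Fin (R * G) → ℂ)
    (i : Fin (nP R Q G)) :
    (Pmat R Q G *ᵥ fun a => x a.modNat * v a) i =
      selectedCoord R Q G x i * (Pmat R Q G *ᵥ v) i := by
  simp only [mulVec, dotProduct, Finset.mul_sum]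
  refine Finset.sum_congr rfl fun a _ => ?_
  rw [← mul_assoc, Pmat_mul_modNat, mul_assoc]

lemma J1mat_eq_diagonal {R Q G : ℕ} (hG : 1 < G) (x : Fin G → ℂ) :
    J1mat R Q G x = diagonal (selectedCoord R Q G x) := by
  ext i k
  have hP : ∀ a, Pmat R Q G i a * x a.modNat * Pmat R Q G k a =
      if i = k then Pmat R Q G i a * x a.modNat else 0 := by
    intro a
    simp only [Pmat, of_apply]
    by_cases h₁ : rowIdx G (betaP R Q G) i = a
    · by_cases h₂ : rowIdx G (betaP R Q G) k = a
      · have hik : i = k := Fin.ext (rowIdx_injective hG _ (h₁.trans h₂.symm))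
        simp [hik, h₂]
      · have hik : i ≠ k := by rintro rfl; exact h₂ h₁
        simp [hik, h₂]
    · simp [h₁]
  rw [J1mat, kronId_diagonal, mul_apply, diagonal_apply]
  simp only [mul_diagonal, transpose_apply, hP]
  split_ifs with hik
  · simp only [Pmat, of_apply, ite_mul, one_mul, zero_mul, selectedCoord]
    split_ifs with hi
    · rw [Finset.sum_eq_single ⟨_, hi⟩]
      · simp
      · intro b _ hb
        exact if_neg fun h' => hb (Fin.ext h'.symm)
      · simp
    · exact Finset.sum_eq_zero fun a _ => if_neg fun h' => hi (by rw [h']; exact a.isLt)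
  · simp

lemma J3mat_eq_diagonal (R Q G : ℕ) (x : Fin G → ℂ) :
    J3mat R Q G x = diagonal fun j : Fin (nP R Q G) =>
      if (j : ℕ) < R * Q then 1 else (entryAt x (alphaP R Q G + ((j : ℕ) - R * Q)))⁻¹ :=
  rfl

lemma Jmat_eq_mul {R Q G : ℕ} (hG : 1 < G) (A : Matrix (Fin G) (Fin Q) ℂ) (x : Fin G → ℂ)
    (h : Fin (R * Q) → ℂ) (hx : ∀ i : Fin G, alphaP R Q G ≤ (i : ℕ) → x i ≠ 0) :
    Jmat R Q G A h x = J1mat R Q G x * J2mat R Q G A h * J3mat R Q G x := by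
  ext i j
  rw [J1mat_eq_diagonal hG, J3mat_eq_diagonal, mul_diagonal, diagonal_mul]
  simp only [Jmat, J2mat, bigMat, of_apply]
  split_ifs with hj
  · rw [kronId_mul, kronId_diagonal, mul_one]
    have hrow : ∀ a, (diagonal (fun a : Fin (R * G) => x a.modNat) * kronId R A) a ⟨j, hj⟩ =
        x a.modNat * kronId R A a ⟨j, hj⟩ := fun a => diagonal_mul ..
    rw [mul_apply, mul_apply]
    simpa only [hrow, mulVec, dotProduct] using
      Pmat_mulVec_modNat_mul R Q G x (fun a => kronId R A a ⟨j, hj⟩) i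
  · have hk : alphaP R Q G + ((j : ℕ) - R * Q) < G := by
      have := j.isLt
      simp only [nP] at this
      omega
    have hne : x ⟨_, hk⟩ ≠ 0 := hx _ (Nat.le_add_right _ _)
    have hcol : (fun a => x a.modNat * aVec R A (alphaP R Q G + ((j : ℕ) - R * Q)) h a) =
        x ⟨_, hk⟩ • aVec R A (alphaP R Q G + ((j : ℕ) - R * Q)) h := by
      ext a
      rw [Pi.smul_apply, smul_eq_mul, aVec_apply]
      split_ifs with ha
      · rw [show a.modNat = ⟨_, hk⟩ from Fin.ext ha]
      · simp
    rw [← Pmat_mulVec_modNat_mul, hcol, mulVec_smul, Pi.smul_apply, smul_eq_mul, entryAt,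
      dif_pos hk, mul_right_comm, mul_inv_cancel₀ hne, one_mul]

/-- Lemma 4 of the paper: factorization of the Jacobian determinant,
`det J(h,x) = det J1(x) · det J2(h) · det J3(x)` whenever `x_i ≠ 0` for all
`i ∈ {α+1, …, G}` (1-based), i.e. for all 0-based indices `i` with `α ≤ i`. -/
theorem jacobian_det_factorization (R Q G : ℕ) (hR : 1 ≤ R) (hQ : 1 ≤ Q) (hQG : Q < G)
    (A : Matrix (Fin G) (Fin Q) ℂ) (x : Fin G → ℂ) (h : Fin (R * Q) → ℂ)
    (hx : ∀ i : Fin G, alphaP R Q G ≤ (i : ℕ) → x i ≠ 0) :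
    (Jmat R Q G A h x).det =
      (J1mat R Q G x).det * (J2mat R Q G A h).det * (J3mat R Q G x).det := by
  rw [Jmat_eq_mul (hQ.trans_lt hQG) A x h hx, det_mul, det_mul]
end
end

section
/- Fix (x_1,…,x_α) ∈ ℂ^α with x_i ≠ 0 for all i ∈ {1,…,α}. Define φ : ℂ^{RQ} × ℂ^{G−α} → ℂ^n by φ(h, w) := P (I_R ⊗ diag(x) A) h, where x := (x_1,…,x_α, w_1,…,w_{G−α}) ∈ ℂ^G. Then φ is injective on the set S := { (h, w) ∈ ℂ^{RQ} × ℂ^{G−α} : w_j ≠ 0 for all j, and det J2(h) ≠ 0 }; i.e., if (h,w), (h′,w′) ∈ S and φ(h,w) = φ(h′,w′), then (h,w) = (h′,w′). -/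
open Matrix MeasureTheory
open scoped Kronecker

noncomputable section

/-- The vector `x = (x_1, …, x_α, w_1, …, w_{G−α}) ∈ ℂ^G` obtained by appending
`w ∈ ℂ^{G−α}` to the fixed `(x_1, …, x_α) ∈ ℂ^α`. -/
def xOf (R Q G : ℕ) (xp : Fin (alphaP R Q G) → ℂ) (w : Fin (G - alphaP R Q G) → ℂ) :
    Fin G → ℂ := fun i =>
  if h1 : (i : ℕ) < alphaP R Q G then xp ⟨(i : ℕ), h1⟩
  else if h2 : (i : ℕ) - alphaP R Q G < G - alphaP R Q G then w ⟨(i : ℕ) - alphaP R Q G, h2⟩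
  else 0

/-- `φ(h, w) := P (I_R ⊗ diag(x) A) h` with `x := (x_1, …, x_α, w_1, …, w_{G−α})`. -/
def phiMap (R Q G : ℕ) (A : Matrix (Fin G) (Fin Q) ℂ) (xp : Fin (alphaP R Q G) → ℂ)
    (p : (Fin (R * Q) → ℂ) × (Fin (G - alphaP R Q G) → ℂ)) : Fin (nP R Q G) → ℂ :=
  (Pmat R Q G * kronId R (Matrix.diagonal (xOf R Q G xp p.2) * A)).mulVec p.1

/-- Each coordinate of `P v` is either identically zero or a fixed coordinate of `v`. -/
theorem Pmat_mulVec_apply (R Q G : ℕ) (i : Fin (nP R Q G)) :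
    (∀ v, (Pmat R Q G *ᵥ v) i = 0) ∨ ∃ k, ∀ v, (Pmat R Q G *ᵥ v) i = v k := by
  by_cases hk : rowIdx G (betaP R Q G) i < R * G
  · right
    refine ⟨⟨_, hk⟩, fun v => ?_⟩
    rw [Matrix.mulVec, dotProduct, Finset.sum_eq_single ⟨_, hk⟩]
    · simp [Pmat]
    · intro j _ hj
      have : rowIdx G (betaP R Q G) i ≠ j := fun h => hj (Fin.ext h.symm)
      simp [Pmat, this]
    · simp
  · left
    intro v
    rw [Matrix.mulVec, dotProduct]
    refine Finset.sum_eq_zero fun j _ => ?_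
    have : rowIdx G (betaP R Q G) i ≠ j := fun h => hk (h ▸ j.isLt)
    simp [Pmat, this]

theorem kronId_diagonal_mul_mulVec (R : ℕ) {G Q : ℕ} (d : Fin G → ℂ)
    (A : Matrix (Fin G) (Fin Q) ℂ) (h : Fin (R * Q) → ℂ) (k : Fin (R * G)) :
    (kronId R (Matrix.diagonal d * A) *ᵥ h) k =
      d (finProdFinEquiv.symm k).2 * (kronId R A *ᵥ h) k := by
  simp only [Matrix.mulVec, dotProduct, Finset.mul_sum]
  refine Finset.sum_congr rfl fun j _ => ?_
  simp only [kronId, Matrix.reindex_apply, Matrix.submatrix_apply, Matrix.kroneckerMap_apply,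
    Matrix.diagonal_mul]
  ring

theorem nP_eq_add {R Q G : ℕ} (hα : alphaP R Q G ≤ G) :
    nP R Q G = R * Q + (G - alphaP R Q G) := by
  unfold nP
  omega

theorem alphaP_le {R Q G : ℕ} (hQG : Q < G) : alphaP R Q G ≤ G := by
  have : R * Q ≤ R * G := Nat.mul_le_mul_left R hQG.le
  unfold alphaP
  omega

theorem xOf_castLE {R Q G : ℕ} (hα : alphaP R Q G ≤ G) (xp : Fin (alphaP R Q G) → ℂ)
    (w : Fin (G - alphaP R Q G) → ℂ) (i : Fin (alphaP R Q G)) :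
    xOf R Q G xp w (Fin.castLE hα i) = xp i := by
  simp [xOf]

theorem xOf_add {R Q G : ℕ} (xp : Fin (alphaP R Q G) → ℂ)
    (w : Fin (G - alphaP R Q G) → ℂ) (t : Fin (G - alphaP R Q G)) :
    xOf R Q G xp w ⟨alphaP R Q G + t, by omega⟩ = w t := by
  simp [xOf]

theorem xOf_ne_zero {R Q G : ℕ} {xp : Fin (alphaP R Q G) → ℂ}
    {w : Fin (G - alphaP R Q G) → ℂ} (hxp : ∀ i, xp i ≠ 0) (hw : ∀ j, w j ≠ 0) (g : Fin G) :
    xOf R Q G xp w g ≠ 0 := by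
  unfold xOf
  split_ifs with h1 h2
  · exact hxp _
  · exact hw _
  · omega

/-- `J2(h)` applied to a stacked vector `(u, v)`, in terms of the diagonal matrix whose
diagonal is `v` extended by zero on the first `α` entries. -/
theorem J2mat_mulVec {R Q G : ℕ} (hn : nP R Q G = R * Q + (G - alphaP R Q G))
    (A : Matrix (Fin G) (Fin Q) ℂ) (h u : Fin (R * Q) → ℂ)
    (d : Fin G → ℂ) (hd : ∀ g : Fin G, (g : ℕ) < alphaP R Q G → d g = 0) :
    J2mat R Q G A h *ᵥ (fun j => Fin.append u
        (fun t : Fin (G - alphaP R Q G) => d ⟨alphaP R Q G + t, by omega⟩) (Fin.cast hn j)) =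
      Pmat R Q G *ᵥ (kronId R A *ᵥ u + kronId R (Matrix.diagonal d * A) *ᵥ h) := by
  funext i
  rw [Matrix.mulVec_add, Matrix.mulVec_mulVec, Pi.add_apply, Matrix.mulVec, dotProduct,
    ← (finCongr hn.symm).sum_comp, Fin.sum_univ_add]
  congr 1
  · simp [J2mat, bigMat, Matrix.mulVec, dotProduct]
  · simp only [J2mat, bigMat, finCongr_apply, Matrix.of_apply, Fin.val_cast, Fin.val_natAdd,
      Fin.cast_cast, Fin.cast_eq_self, Fin.append_right]
    rcases Pmat_mulVec_apply R Q G i with hP | ⟨k, hP⟩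
    · simp [hP]
    · simp only [hP, aVec, kronId_diagonal_mul_mulVec]
      set g := (finProdFinEquiv.symm k).2
      by_cases hα : (g : ℕ) < alphaP R Q G
      · rw [hd g hα, zero_mul]
        refine Finset.sum_eq_zero fun t _ => ?_
        have : (g : ℕ) ≠ alphaP R Q G + t := by omega
        simp [this]
      · rw [Finset.sum_eq_single ⟨g - alphaP R Q G, by omega⟩]
        · have : alphaP R Q G + ((g : ℕ) - alphaP R Q G) = g := by omega
          simp [this, mul_comm]
        · intro t _ ht
          have : (g : ℕ) ≠ alphaP R Q G + t := fun e => ht (Fin.ext (by simp [e]))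
          simp [this]
        · simp

/-- Core injectivity claim of Lemma 3: for fixed `(x_1, …, x_α)` with all entries
nonzero, `φ` is injective on the set of pairs `(h, w)` with all entries of `w`
nonzero and `det J2(h) ≠ 0`. -/
theorem phi_injective_on (R Q G : ℕ) (hR : 1 ≤ R) (hQ : 1 ≤ Q) (hQG : Q < G)
    (A : Matrix (Fin G) (Fin Q) ℂ) (xp : Fin (alphaP R Q G) → ℂ)
    (hxp : ∀ i, xp i ≠ 0) :
    Set.InjOn (phiMap R Q G A xp)
      {p : (Fin (R * Q) → ℂ) × (Fin (G - alphaP R Q G) → ℂ) |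
        (∀ j, p.2 j ≠ 0) ∧ (J2mat R Q G A p.1).det ≠ 0} := by
  rintro ⟨h, w⟩ ⟨hw, -⟩ ⟨h', w'⟩ ⟨-, hdet⟩ heq
  have hα : alphaP R Q G ≤ G := alphaP_le hQG
  have hn := nP_eq_add hα
  have hx : ∀ g, xOf R Q G xp w g ≠ 0 := xOf_ne_zero hxp hw
  let d : Fin G → ℂ := fun g => 1 - xOf R Q G xp w' g / xOf R Q G xp w g
  have hd : ∀ g : Fin G, (g : ℕ) < alphaP R Q G → d g = 0 := by
    intro g hg
    have h1 := xOf_castLE hα xp w ⟨g, hg⟩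
    have h2 := xOf_castLE hα xp w' ⟨g, hg⟩
    simp only [Fin.castLE_mk, Fin.eta] at h1 h2
    simp [d, h1, h2, hxp]
  have hker := J2mat_mulVec hn A h' (h - h') d hd
  have hzero : Pmat R Q G *ᵥ
      (kronId R A *ᵥ (h - h') + kronId R (Matrix.diagonal d * A) *ᵥ h') = 0 := by
    funext i
    have hi := congrFun heq i
    simp only [phiMap, ← Matrix.mulVec_mulVec] at hi
    rcases Pmat_mulVec_apply R Q G i with hP | ⟨k, hP⟩
    · simp [hP]
    · rw [hP, hP, kronId_diagonal_mul_mulVec, kronId_diagonal_mul_mulVec] at hi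
      rw [hP, Pi.add_apply, kronId_diagonal_mul_mulVec, Matrix.mulVec_sub, Pi.sub_apply,
        Pi.zero_apply]
      have := hx (finProdFinEquiv.symm k).2
      simp only [d]
      field_simp
      linear_combination hi
  have hz := Matrix.eq_zero_of_mulVec_eq_zero hdet (hker.trans hzero)
  have hh : h = h' := by
    funext j
    have := congrFun hz (Fin.cast hn.symm (Fin.castAdd _ j))
    simpa [sub_eq_zero] using this
  have hww : w = w' := by
    funext t
    have := congrFun hz (Fin.cast hn.symm (Fin.natAdd _ t))
    simp only [Fin.cast_cast, Fin.cast_eq_self, Fin.append_right, Pi.zero_apply, d, xOf_add,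
      sub_eq_zero] at this
    exact ((div_eq_one_iff_eq (hw t)).mp this.symm).symm
  rw [hh, hww]
end
end
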